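/- Let K : ℝ → ℝ be continuous and without conjugate points with K(t) > −k² for all t ∈ ℝ for some k > 0, let J^z be the solution of the Jacobi equation with J^z(0) = 0 and (J^z)'(0) = 1, for r > 0 let J^r be the unique solution with J^r(0) = 1 and J^r(r) = 0, and let J^{+∞} be the solution with J^{+∞}(0) = 1 and (J^{+∞})'(0) = lim_{r→+∞} (J^r)'(0) (this limit exists). Then for every t > 0 the improper integral ∫ₜ^{+∞} (J^z(u))⁻² du converges and J^{+∞}(t) = J^z(t) · ∫ₜ^{+∞} (J^z(u))⁻² du. -/

import Mathlib

open Set MeasureTheory Filter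

/-- A solution of the scalar Jacobi equation `J'' + K·J = 0`. -/
def IsJacobiSolution (K J : ℝ → ℝ) : Prop :=
  ContDiff ℝ 2 J ∧ ∀ t : ℝ, deriv (deriv J) t + K t * J t = 0

/-- `K` is without conjugate points: any solution vanishing at two distinct
points vanishes identically. -/
def WithoutConjugatePoints (K : ℝ → ℝ) : Prop :=
  ∀ J : ℝ → ℝ, IsJacobiSolution K J →
    ∀ a b : ℝ, a ≠ b → J a = 0 → J b = 0 → ∀ t : ℝ, J t = 0

namespace IsJacobiSolution

variable {K J L : ℝ → ℝ}

theorem hasDerivAt (h : IsJacobiSolution K J) (t : ℝ) : HasDerivAt J (deriv J t) t :=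
  (h.1.differentiable (by norm_num) t).hasDerivAt

theorem hasDerivAt_deriv (h : IsJacobiSolution K J) (t : ℝ) :
    HasDerivAt (deriv J) (-(K t * J t)) t := by
  have h1 : ContDiff ℝ 1 (deriv J) := ((contDiff_succ_iff_deriv (n := 1)).1 h.1).2.2
  have h2 := (h1.differentiable (by norm_num) t).hasDerivAt
  rwa [eq_neg_of_add_eq_zero_left (h.2 t)] at h2

theorem linearCombination (hJ : IsJacobiSolution K J) (hL : IsJacobiSolution K L) (a b : ℝ) :
    IsJacobiSolution K (fun t => a * J t + b * L t) := by
  refine ⟨(contDiff_const.mul hJ.1).add (contDiff_const.mul hL.1), fun t => ?_⟩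
  have h1 : deriv (fun t => a * J t + b * L t) = fun t => a * deriv J t + b * deriv L t :=
    funext fun s => (((hJ.hasDerivAt s).const_mul a).add ((hL.hasDerivAt s).const_mul b)).deriv
  have h2 : deriv (fun t => a * deriv J t + b * deriv L t) t =
      a * -(K t * J t) + b * -(K t * L t) :=
    (((hJ.hasDerivAt_deriv t).const_mul a).add ((hL.hasDerivAt_deriv t).const_mul b)).deriv
  rw [h1, h2]
  ring

/-- The Wronskian of two solutions is constant. -/
theorem wronskian_eq (hJ : IsJacobiSolution K J) (hL : IsJacobiSolution K L) (s t : ℝ) :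
    J s * deriv L s - deriv J s * L s = J t * deriv L t - deriv J t * L t := by
  have h : ∀ u, HasDerivAt (fun u => J u * deriv L u - deriv J u * L u) 0 u := fun u =>
    (((hJ.hasDerivAt u).mul (hL.hasDerivAt_deriv u)).sub
      ((hJ.hasDerivAt_deriv u).mul (hL.hasDerivAt u))).congr_deriv (by ring)
  exact is_const_of_deriv_eq_zero (fun u => (h u).differentiableAt) (fun u => (h u).deriv) s t

/-- Without conjugate points, two solutions vanishing at `0` are proportional. -/
theorem mul_deriv_zero_eq (hK : WithoutConjugatePoints K) (hJ : IsJacobiSolution K J)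
    (hL : IsJacobiSolution K L) (hJ0 : J 0 = 0) (hL0 : L 0 = 0) {t : ℝ} (ht : t ≠ 0) :
    L t * deriv J 0 = J t * deriv L 0 := by
  have h := hK _ (hJ.linearCombination hL (L t) (-J t)) 0 t ht.symm (by simp [hJ0, hL0]) (by ring)
  have h1 := ((hJ.hasDerivAt 0).const_mul (L t)).add ((hL.hasDerivAt 0).const_mul (-J t))
  have h2 : HasDerivAt (fun s => L t * J s + -J t * L s) 0 0 := by
    rw [funext h]
    exact hasDerivAt_const 0 0
  linarith [h1.unique h2]

theorem ne_zero_of_ne (hK : WithoutConjugatePoints K) (hJ : IsJacobiSolution K J)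
    (hJ0 : J 0 = 0) (hJ0' : deriv J 0 ≠ 0) {t : ℝ} (ht : t ≠ 0) : J t ≠ 0 := fun h => by
  refine hJ0' ?_
  rw [funext (hK J hJ 0 t ht.symm hJ0 h)]
  simp

end IsJacobiSolution

theorem stmt_16 (K : ℝ → ℝ) (hK : Continuous K)
    (hwcp : WithoutConjugatePoints K) (k : ℝ) (hk : 0 < k)
    (hKk : ∀ t : ℝ, -k ^ 2 < K t)
    (Jz : ℝ → ℝ) (hJz : IsJacobiSolution K Jz) (hJz0 : Jz 0 = 0)
    (hJz0' : deriv Jz 0 = 1)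
    (Jfam : ℝ → ℝ → ℝ)
    (hJfam : ∀ r : ℝ, 0 < r →
      IsJacobiSolution K (Jfam r) ∧ Jfam r 0 = 1 ∧ Jfam r r = 0)
    (Jinf : ℝ → ℝ) (hJinf : IsJacobiSolution K Jinf) (hJinf0 : Jinf 0 = 1)
    (hJinf0' : Tendsto (fun r => deriv (Jfam r) 0) atTop (nhds (deriv Jinf 0))) :
    ∀ t : ℝ, 0 < t →
      IntegrableOn (fun u => (Jz u ^ 2)⁻¹) (Ioi t) ∧
      Jinf t = Jz t * ∫ u in Ioi t, (Jz u ^ 2)⁻¹ := by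
  have hne : ∀ {u : ℝ}, 0 < u → Jz u ≠ 0 := fun hu =>
    hJz.ne_zero_of_ne hwcp hJz0 (by simp [hJz0']) hu.ne'
  have hderiv : ∀ u, 0 < u → HasDerivAt (fun u => -(Jinf u / Jz u)) (Jz u ^ 2)⁻¹ u := by
    intro u hu
    have hW := hJinf.wronskian_eq hJz u 0
    rw [hJinf0, hJz0, hJz0'] at hW
    refine ((hJinf.hasDerivAt u).div (hJz.hasDerivAt u) (hne hu)).neg.congr_deriv ?_
    rw [← neg_div, inv_eq_one_div]
    congr 1
    linarith
  have hquot : ∀ r, 0 < r → -(Jinf r / Jz r) = deriv (Jfam r) 0 - deriv Jinf 0 := by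
    intro r hr
    obtain ⟨hJ, hJ0, hJr⟩ := hJfam r hr
    have h := (hJinf.linearCombination hJ 1 (-1)).mul_deriv_zero_eq hwcp hJz
      (by simp [hJinf0, hJ0]) hJz0 hr.ne'
    have hd := (((hJinf.hasDerivAt 0).const_mul 1).add ((hJ.hasDerivAt 0).const_mul (-1))).deriv
    have hd' : deriv (fun t => 1 * Jinf t + -1 * Jfam r t) 0 =
        1 * deriv Jinf 0 + -1 * deriv (Jfam r) 0 := hd
    rw [hd', hJz0', hJr] at h
    have := hne hr
    field_simp
    linarith
  have hlim : Tendsto (fun u => -(Jinf u / Jz u)) atTop (nhds 0) := by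
    have h := hJinf0'.sub_const (deriv Jinf 0)
    rw [sub_self] at h
    refine h.congr' ?_
    filter_upwards [eventually_gt_atTop 0] with r hr using (hquot r hr).symm
  intro t ht
  have hd : ∀ u ∈ Ici t, HasDerivAt (fun u => -(Jinf u / Jz u)) (Jz u ^ 2)⁻¹ u :=
    fun u hu => hderiv u (ht.trans_le hu)
  have hpos : ∀ u ∈ Ioi t, 0 ≤ (Jz u ^ 2)⁻¹ := fun u _ => by positivity
  refine ⟨integrableOn_Ioi_deriv_of_nonneg' hd hpos hlim, ?_⟩
  rw [integral_Ioi_of_hasDerivAt_of_nonneg' hd hpos hlim]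
  have := hne ht
  field_simp
  ring
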